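/- Fix a finite sequence of positive integers (a_1,…,a_n) and an integer m > 0. Then Φ(β^N) → ∞ as N → ∞. -/

import Mathlib

open scoped Real ENNReal
open Filter

/-- The Gauss-map iterates: `alphaIter θ k` is `α_{k+1}(θ)`, i.e. `alphaIter θ 0 = α_1(θ) = θ`
and `α_{i+1}(θ)` is the fractional part of `1/α_i(θ)`. -/
noncomputable def alphaIter (θ : ℝ) : ℕ → ℝ
  | 0 => θ
  | k + 1 => Int.fract (1 / alphaIter θ k)

/-- `HasCF θ a` : `θ` is an irrational number in `(0,1)` whose continued fraction digits
are given by `a` (0-indexed: `a k` is the digit `a_{k+1}` in 1-indexed notation). -/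
def HasCF (θ : ℝ) (a : ℕ → ℕ) : Prop :=
  θ ∈ Set.Ioo (0 : ℝ) 1 ∧ Irrational θ ∧ ∀ k, ⌊1 / alphaIter θ k⌋ = (a k : ℤ)

/-- Yoccoz's Brjuno function `Φ(θ) = Σ_{n≥1} α_1(θ)⋯α_{n-1}(θ)·log(1/α_n(θ))`,
as a real-valued sum. -/
noncomputable def brjunoPhi (θ : ℝ) : ℝ :=
  ∑' k : ℕ, (∏ j ∈ Finset.range k, alphaIter θ j) * Real.log (1 / alphaIter θ k)

/-- Yoccoz's Brjuno function with values in `ℝ≥0∞` (all terms are nonnegative). -/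
noncomputable def brjunoPhiE (θ : ℝ) : ℝ≥0∞ :=
  ∑' k : ℕ, ENNReal.ofReal ((∏ j ∈ Finset.range k, alphaIter θ j) * Real.log (1 / alphaIter θ k))

/-- Digits of the noble number `ω = [a_1,…,a_n,1,1,1,…]`. -/
def nobleDigits (n : ℕ) (a : ℕ → ℕ) : ℕ → ℕ := fun k => if k < n then a k else 1

/-- Digits of `β^N = [a_1,…,a_n,1,…,1,N,1,1,…]`, with `N` in (1-indexed) position `n+m`. -/
def betaDigits (n m N : ℕ) (a : ℕ → ℕ) : ℕ → ℕ :=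
  fun k => if k + 1 = n + m then N else if k < n then a k else 1

/-- Digits of `β^I = [a_1,…,a_n,1,…,1,b_{n+m},b_{n+m+1},…]`: the digits of the noble number
with the whole tail from (1-indexed) position `n+m` on replaced by the tail `b`. -/
def tailDigits (n m : ℕ) (a b : ℕ → ℕ) : ℕ → ℕ :=
  fun k => if k + 1 < n + m then (if k < n then a k else 1) else b k

theorem alphaIter_mem_Ioo_and_irrational {θ : ℝ} (h : θ ∈ Set.Ioo (0 : ℝ) 1)
    (hirr : Irrational θ) (k : ℕ) :
    alphaIter θ k ∈ Set.Ioo (0 : ℝ) 1 ∧ Irrational (alphaIter θ k) := by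
  induction k with
  | zero => exact ⟨h, hirr⟩
  | succ k ih =>
    have hi : Irrational (alphaIter θ (k + 1)) := by
      have h1 : Irrational (1 / alphaIter θ k) := by
        simpa [one_div] using ih.2.inv
      simpa only [alphaIter, Int.fract] using h1.sub_intCast ⌊1 / alphaIter θ k⌋
    refine ⟨⟨lt_of_le_of_ne (Int.fract_nonneg _) ?_, Int.fract_lt_one _⟩, hi⟩
    exact hi.ne_zero.symm

namespace HasCF

variable {θ : ℝ} {d : ℕ → ℕ}

theorem alphaIter_pos (h : HasCF θ d) (k : ℕ) : 0 < alphaIter θ k :=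
  (alphaIter_mem_Ioo_and_irrational h.1 h.2.1 k).1.1

theorem alphaIter_lt_one (h : HasCF θ d) (k : ℕ) : alphaIter θ k < 1 :=
  (alphaIter_mem_Ioo_and_irrational h.1 h.2.1 k).1.2

theorem one_div_alphaIter (h : HasCF θ d) (k : ℕ) :
    1 / alphaIter θ k = d k + alphaIter θ (k + 1) := by
  have h1 := Int.floor_add_fract (1 / alphaIter θ k)
  rw [h.2.2 k] at h1
  simpa [alphaIter] using h1.symm

theorem one_le_digit (h : HasCF θ d) (k : ℕ) : (1 : ℝ) ≤ d k := by
  have h1 : (1 : ℤ) ≤ ⌊1 / alphaIter θ k⌋ :=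
    Int.le_floor.2 (by simpa using (one_le_one_div (h.alphaIter_pos k) (h.alphaIter_lt_one k).le))
  rw [h.2.2 k] at h1
  exact_mod_cast h1

theorem one_div_digit_add_one_le (h : HasCF θ d) (k : ℕ) :
    1 / ((d k : ℝ) + 1) ≤ alphaIter θ k := by
  rw [one_div_le (by positivity) (h.alphaIter_pos k), h.one_div_alphaIter k]
  linarith [h.alphaIter_lt_one (k + 1)]

theorem alphaIter_mul_succ_le (h : HasCF θ d) (k : ℕ) :
    alphaIter θ k * alphaIter θ (k + 1) ≤ 1 / 2 := by
  have h0 := h.alphaIter_pos k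
  have h1 : alphaIter θ k * (d k + alphaIter θ (k + 1)) = 1 := by
    rw [← h.one_div_alphaIter k]; field_simp
  nlinarith [h.one_le_digit k, h.alphaIter_lt_one (k + 1)]

theorem log_one_div_alphaIter_nonneg (h : HasCF θ d) (k : ℕ) :
    0 ≤ Real.log (1 / alphaIter θ k) :=
  Real.log_nonneg (one_le_one_div (h.alphaIter_pos k) (h.alphaIter_lt_one k).le)

theorem prod_alphaIter_nonneg (h : HasCF θ d) (k : ℕ) :
    0 ≤ ∏ j ∈ Finset.range k, alphaIter θ j :=
  Finset.prod_nonneg fun j _ => (h.alphaIter_pos j).le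

theorem prod_alphaIter_le (h : HasCF θ d) (k : ℕ) :
    ∏ j ∈ Finset.range k, alphaIter θ j ≤ 2 * (3 / 4 : ℝ) ^ k := by
  induction k using Nat.twoStepInduction with
  | zero => norm_num
  | one => have := h.alphaIter_lt_one 0; norm_num; linarith
  | more k ih _ =>
    rw [Finset.prod_range_succ, Finset.prod_range_succ, mul_assoc, pow_add]
    nlinarith [mul_le_mul_of_nonneg_left (h.alphaIter_mul_succ_le k) (h.prod_alphaIter_nonneg k),
      pow_pos (show (0 : ℝ) < 3 / 4 by norm_num) k]

/-- The Brjuno series of an irrational number with bounded digits converges. -/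
theorem summable_brjuno (h : HasCF θ d) {B : ℕ} (hB : ∀ k, d k ≤ B) :
    Summable fun k : ℕ =>
      (∏ j ∈ Finset.range k, alphaIter θ j) * Real.log (1 / alphaIter θ k) := by
  refine Summable.of_nonneg_of_le
    (fun k => mul_nonneg (h.prod_alphaIter_nonneg k) (h.log_one_div_alphaIter_nonneg k))
    (fun k => mul_le_mul (h.prod_alphaIter_le k) (?_ : _ ≤ Real.log (B + 1))
      (h.log_one_div_alphaIter_nonneg k) (by positivity))
    (((summable_geometric_of_lt_one (by norm_num) (by norm_num)).mul_left 2).mul_right _)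
  refine Real.log_le_log (one_div_pos.2 (h.alphaIter_pos k)) ?_
  have hBk : (d k : ℝ) ≤ B := by exact_mod_cast hB k
  rw [h.one_div_alphaIter k]
  linarith [h.alphaIter_lt_one (k + 1)]

/-- A single digit bounds the Brjuno function from below. -/
theorem prod_mul_log_digit_le_brjunoPhi (h : HasCF θ d) {B : ℕ} (hB : ∀ k, d k ≤ B) (k : ℕ) :
    (∏ j ∈ Finset.range k, 1 / ((d j : ℝ) + 1)) * Real.log (d k) ≤ brjunoPhi θ := by
  have hd := h.one_le_digit k
  calc _ ≤ (∏ j ∈ Finset.range k, alphaIter θ j) * Real.log (1 / alphaIter θ k) := by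
        refine mul_le_mul ?_ ?_ (Real.log_nonneg hd) (h.prod_alphaIter_nonneg k)
        · exact Finset.prod_le_prod (fun j _ => by positivity)
            fun j _ => h.one_div_digit_add_one_le j
        · refine Real.log_le_log (by linarith) ?_
          rw [h.one_div_alphaIter k]
          linarith [h.alphaIter_pos (k + 1)]
    _ ≤ brjunoPhi θ := (h.summable_brjuno hB).le_tsum k fun j _ =>
        mul_nonneg (h.prod_alphaIter_nonneg j) (h.log_one_div_alphaIter_nonneg j)

end HasCF

theorem betaDigits_le (n m N : ℕ) (a : ℕ → ℕ) (k : ℕ) :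
    betaDigits n m N a k ≤ N + 1 + ∑ i ∈ Finset.range n, a i := by
  unfold betaDigits
  split_ifs with h1 h2
  · omega
  · have := Finset.single_le_sum (f := a) (fun i _ => Nat.zero_le _) (Finset.mem_range.2 h2)
    omega
  · omega

/-- Lemma `lem11`: `Φ(β^N) → ∞` as `N → ∞`. -/
theorem phi_tendsto_atTop
    (n m : ℕ) (hm : 0 < m) (a : ℕ → ℕ) (ha : ∀ i < n, 0 < a i)
    (β : ℕ → ℝ)
    (hβ : ∀ N, 0 < N → HasCF (β N) (betaDigits n m N a)) :
    Tendsto (fun N => brjunoPhi (β N)) atTop atTop := by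
  set c : ℝ := ∏ j ∈ Finset.range (n + m - 1), 1 / ((nobleDigits n a j : ℝ) + 1) with hc
  have hc0 : 0 < c := Finset.prod_pos fun j _ => by positivity
  have hlog : Tendsto (fun N : ℕ => c * Real.log N) atTop atTop :=
    (Real.tendsto_log_atTop.comp tendsto_natCast_atTop_atTop).const_mul_atTop hc0
  refine tendsto_atTop_mono' atTop ?_ hlog
  filter_upwards [eventually_gt_atTop 0] with N hN
  have h := (hβ N hN).prod_mul_log_digit_le_brjunoPhi (betaDigits_le n m N a) (n + m - 1)
  have hdigit : betaDigits n m N a (n + m - 1) = N := if_pos (by omega)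
  have hprod : ∏ j ∈ Finset.range (n + m - 1), 1 / ((betaDigits n m N a j : ℝ) + 1) = c := by
    refine Finset.prod_congr rfl fun j hj => ?_
    have hj' := Finset.mem_range.1 hj
    rw [show betaDigits n m N a j = nobleDigits n a j from if_neg (by omega)]
  rwa [hdigit, hprod] at h
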